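/- arXiv:2302.06437 — 2 statements merged into one kernel-verified Lean document; each statement's English description precedes it below -/
import Mathlib

section
/- Let X be an uncountable set equipped with the cofinite topology (the open sets are the empty set and the sets with finite complement). Then the space Q_p(X,ℝ) of quasicontinuous real-valued functions on X with the topology of pointwise convergence is Fréchet–Urysohn. -/
open Set Filter Topology

section Defs

variable {X : Type*}

/-- `f : X → ℝ` is quasicontinuous: for every `x` and open sets `U ∋ x`, `V ∋ f x`
there is a nonempty open `W ⊆ U` with `f '' W ⊆ V`. -/
def Quasicontinuous [TopologicalSpace X] (f : X → ℝ) : Prop :=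
  ∀ x : X, ∀ U : Set X, IsOpen U → x ∈ U → ∀ V : Set ℝ, IsOpen V → f x ∈ V →
    ∃ W : Set X, IsOpen W ∧ W.Nonempty ∧ W ⊆ U ∧ f '' W ⊆ V

/-- `Q_p(X, ℝ)`: the quasicontinuous functions with the topology of pointwise
convergence (subspace of the product topology on `X → ℝ`). -/
abbrev Qp (X : Type*) [TopologicalSpace X] : Type _ :=
  {f : X → ℝ // Quasicontinuous f}

/-- A space is semi-regular if the regular open sets (`U = int (cl U)`) form a base. -/
def SemiRegular (X : Type*) [TopologicalSpace X] : Prop :=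
  TopologicalSpace.IsTopologicalBasis {U : Set X | U = interior (closure U)}

/-- Open Whyburn space. -/
def OpenWhyburn (X : Type*) [TopologicalSpace X] : Prop :=
  ∀ A : Set X, IsOpen A → ∀ x ∈ closure A \ A,
    ∃ B : Set X, IsOpen B ∧ B ⊆ A ∧ closure B \ A = {x}

/-- A set `A` is minimally bounded if `A ⊆ cl (int A)` and `int (cl A) ⊆ A`. -/
def MinimallyBounded [TopologicalSpace X] (A : Set X) : Prop :=
  A ⊆ closure (interior A) ∧ interior (closure A) ⊆ A

end Defs

theorem Quasicontinuous.apply_eq {X : Type*} [TopologicalSpace X] [PreirreducibleSpace X]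
    {f : X → ℝ} (hf : Quasicontinuous f) (x y : X) : f x = f y := by
  by_contra hne
  obtain ⟨u, v, hu, hv, hxu, hyv, huv⟩ := t2_separation hne
  obtain ⟨W₁, hW₁, hne₁, -, h₁⟩ := hf x univ isOpen_univ (mem_univ x) u hu hxu
  obtain ⟨W₂, hW₂, hne₂, -, h₂⟩ := hf y univ isOpen_univ (mem_univ y) v hv hyv
  obtain ⟨z, hz₁, hz₂⟩ := nonempty_preirreducible_inter hW₁ hW₂ hne₁ hne₂
  exact huv.le_bot ⟨h₁ (mem_image_of_mem f hz₁), h₂ (mem_image_of_mem f hz₂)⟩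

theorem quasicontinuous_const {X : Type*} [TopologicalSpace X] (c : ℝ) :
    Quasicontinuous (fun _ : X => c) := by
  intro x U hU hx V _ hc
  refine ⟨U, hU, ⟨x, hx⟩, Subset.rfl, ?_⟩
  rintro _ ⟨_, _, rfl⟩
  exact hc

theorem Qp.isEmbedding_eval {X : Type*} [TopologicalSpace X] [PreirreducibleSpace X] (x : X) :
    IsEmbedding (fun f : Qp X => f.1 x) := by
  let const : ℝ → Qp X := fun c => ⟨fun _ => c, quasicontinuous_const c⟩
  have hconst : Continuous const :=
    Continuous.subtype_mk (continuous_pi fun _ => continuous_id) _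
  have heval : Continuous (fun f : Qp X => f.1 x) :=
    (continuous_apply x).comp continuous_subtype_val
  have hinv : Function.LeftInverse const (fun f : Qp X => f.1 x) :=
    fun f => Subtype.ext (funext fun y => f.2.apply_eq x y)
  exact IsEmbedding.of_leftInverse hinv hconst heval

theorem preirreducibleSpace_of_isOpen_iff_cofinite {X : Type*} [Infinite X] [TopologicalSpace X]
    (hco : ∀ s : Set X, IsOpen s ↔ s = ∅ ∨ sᶜ.Finite) : PreirreducibleSpace X := by
  refine ⟨fun u v hu hv ⟨x, _, hx⟩ ⟨y, _, hy⟩ => ?_⟩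
  have hu' := ((hco u).1 hu).resolve_left (Nonempty.ne_empty ⟨x, hx⟩)
  have hv' := ((hco v).1 hv).resolve_left (Nonempty.ne_empty ⟨y, hy⟩)
  obtain ⟨z, hz⟩ := (hu'.union hv').infinite_compl.nonempty
  rw [← compl_inter, compl_compl] at hz
  exact ⟨z, mem_univ z, hz⟩

theorem qp_cofinite_frechetUrysohn
    (X : Type*) [Uncountable X] [TopologicalSpace X]
    (hco : ∀ s : Set X, IsOpen s ↔ s = ∅ ∨ sᶜ.Finite) :
    FrechetUrysohnSpace (Qp X) := by
  have := preirreducibleSpace_of_isOpen_iff_cofinite hco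
  obtain ⟨x⟩ := (inferInstance : Nonempty X)
  have := (Qp.isEmbedding_eval x).isInducing.firstCountableTopology
  infer_instance
end

section
/- Let X be an uncountable Hausdorff semi-regular open Whyburn space such that the space Q_p(X,ℝ) of quasicontinuous real-valued functions on X with the topology of pointwise convergence is Fréchet–Urysohn. Then X is hereditarily Lindelöf. -/
open Set Filter Topology

section Helpers

variable {X : Type*} [TopologicalSpace X]

/-- If `B` is open and `K ⊆ closure B`, the function vanishing on `interior (closure B) ∪ K` and
equal to `1` elsewhere is quasicontinuous. -/
lemma quasicontinuous_indicator_compl {B K : Set X} (hB : IsOpen B) (hK : K ⊆ closure B) :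
    Quasicontinuous ((interior (closure B) ∪ K)ᶜ.indicator fun _ => (1 : ℝ)) := by
  intro x U hU hxU V _ hxV
  by_cases hx : x ∈ interior (closure B) ∪ K
  · have hxB : x ∈ closure B := hx.elim (fun h => interior_subset h) (fun h => hK h)
    refine ⟨U ∩ B, hU.inter hB, mem_closure_iff.1 hxB U hU hxU, inter_subset_left, ?_⟩
    rintro _ ⟨y, hy, rfl⟩
    have hyA : y ∈ interior (closure B) ∪ K :=
      Or.inl (interior_maximal subset_closure hB hy.2)
    rw [indicator_of_notMem (not_not_intro hx)] at hxV
    rwa [indicator_of_notMem (not_not_intro hyA)]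
  · have hxc : x ∈ closure (closure B)ᶜ := by
      rw [closure_compl]
      exact fun h => hx (Or.inl h)
    refine ⟨U ∩ (closure B)ᶜ, hU.inter isClosed_closure.isOpen_compl,
      mem_closure_iff.1 hxc U hU hxU, inter_subset_left, ?_⟩
    rintro _ ⟨y, hy, rfl⟩
    have hyA : y ∈ (interior (closure B) ∪ K)ᶜ :=
      fun h => hy.2 (h.elim (fun h => interior_subset h) (fun h => hK h))
    rw [indicator_of_mem (show x ∈ (interior (closure B) ∪ K)ᶜ from hx)] at hxV
    rwa [indicator_of_mem hyA]

/-- If `Q_p(X, ℝ)` is Fréchet–Urysohn, then a set `S` is countable as soon as every point of `X`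
lies in the closure of an open set whose closure meets `S` in a countable set. -/
lemma countable_of_forall_exists_isOpen (hFU : FrechetUrysohnSpace (Qp X)) (S : Set X)
    (h : ∀ x : X, ∃ B : Set X, IsOpen B ∧ x ∈ closure B ∧ (closure B ∩ S).Countable) :
    S.Countable := by
  choose B hBo hxB hBS using h
  let zero : Qp X := ⟨fun _ => 0, by
    intro x U hU hxU V _ hxV
    refine ⟨U, hU, ⟨x, hxU⟩, Subset.rfl, ?_⟩
    rintro _ ⟨y, -, rfl⟩
    exact hxV⟩
  have hzero : zero ∈ closure {g : Qp X | {x ∈ S | g.1 x ≠ 1}.Countable} := by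
    rw [mem_closure_iff]
    rintro _ ⟨O, hO, rfl⟩ h0
    obtain ⟨I, u, hu, hIu⟩ := isOpen_pi_iff.1 hO _ h0
    have hcl : closure (⋃ x ∈ (I : Set X), B x) = ⋃ x ∈ (I : Set X), closure (B x) :=
      I.finite_toSet.closure_biUnion B
    have hI : (I : Set X) ⊆ closure (⋃ x ∈ (I : Set X), B x) := fun x hx => by
      rw [hcl]
      exact mem_biUnion hx (hxB x)
    refine ⟨⟨_, quasicontinuous_indicator_compl
      (isOpen_biUnion fun x _ => hBo x) hI⟩, hIu fun x hx => ?_, ?_⟩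
    · have : x ∈ interior (closure (⋃ x ∈ (I : Set X), B x)) ∪ I := Or.inr hx
      simp only
      rw [indicator_of_notMem (not_not_intro this)]
      exact (hu x hx).2
    · have hc : (⋃ x ∈ (I : Set X), closure (B x) ∩ S).Countable :=
        I.countable_toSet.biUnion fun x _ => hBS x
      refine hc.mono ?_
      rintro x ⟨hxS, hx⟩
      have hxA : x ∈ interior (closure (⋃ x ∈ (I : Set X), B x)) ∪ I := by
        by_contra hxA
        exact hx (indicator_of_mem (mem_compl hxA) fun _ => (1 : ℝ))
      have hx' : x ∈ closure (⋃ x ∈ (I : Set X), B x) :=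
        hxA.elim (fun h => interior_subset h) (fun h => hI h)
      rw [hcl] at hx'
      obtain ⟨i, hi, hxi⟩ := mem_iUnion₂.1 hx'
      exact mem_biUnion hi ⟨hxi, hxS⟩
  obtain ⟨g, hg, hlim⟩ := mem_closure_iff_seq_limit.1 hzero
  refine (countable_iUnion hg).mono fun x hx => ?_
  have hgx : Tendsto (fun n => (g n).1 x) atTop (𝓝 0) :=
    (((continuous_apply x).comp continuous_subtype_val).tendsto zero).comp hlim
  obtain ⟨n, hn⟩ := (hgx.eventually_ne zero_ne_one).exists
  exact mem_iUnion.2 ⟨n, hx, hn⟩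

/-- If `X` is open Whyburn and `Q_p(X, ℝ)` is Fréchet–Urysohn, then closed sets with empty interior
are countable. -/
lemma IsClosed.countable_of_interior_eq_empty [T1Space X] (hw : OpenWhyburn X)
    (hFU : FrechetUrysohnSpace (Qp X)) {N : Set X} (hN : IsClosed N) (hN0 : interior N = ∅) :
    N.Countable := by
  refine countable_of_forall_exists_isOpen hFU N fun x => ?_
  suffices ∃ B : Set X, IsOpen B ∧ x ∈ closure B ∧ closure B ∩ N ⊆ {x} by
    obtain ⟨B, hB, hxB, hBN⟩ := this
    exact ⟨B, hB, hxB, (countable_singleton x).mono hBN⟩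
  by_cases hiso : IsOpen {x}
  · exact ⟨{x}, hiso, subset_closure rfl, by simp⟩
  have hxc : x ∈ closure (Nᶜ \ {x}) := by
    rw [mem_closure_iff]
    intro U hU hxU
    by_contra hne
    have hsub : U \ {x} ⊆ N := fun y hy => by
      by_contra hyN
      exact hne ⟨y, hy.1, hyN, hy.2⟩
    have hemp : U \ {x} ⊆ ∅ := hN0 ▸ interior_maximal hsub (hU.sdiff isClosed_singleton)
    have hUx : U = {x} :=
      Subset.antisymm (fun y hy => by
        by_contra hyx
        exact hemp ⟨hy, hyx⟩) (singleton_subset_iff.2 hxU)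
    exact hiso (hUx ▸ hU)
  obtain ⟨B, hB, -, hBx⟩ := hw (Nᶜ \ {x}) (hN.isOpen_compl.sdiff isClosed_singleton) x
    ⟨hxc, fun h => h.2 rfl⟩
  refine ⟨B, hB, (hBx.symm ▸ mem_singleton x : x ∈ closure B \ (Nᶜ \ {x})).1, ?_⟩
  rw [← hBx]
  exact fun y hy => ⟨hy.1, fun h => h.1 hy.2⟩

/-- An uncountable set splits into two disjoint uncountable sets. -/
lemma Set.exists_disjoint_not_countable {α : Type*} {s : Set α} (hs : ¬ s.Countable) :
    ∃ t u : Set α, t ∪ u = s ∧ Disjoint t u ∧ ¬ t.Countable ∧ ¬ u.Countable := by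
  have hinf : s.Infinite := fun h => hs h.countable
  obtain ⟨t, u, htu, hd, hc⟩ := hinf.exists_union_disjoint_cardinal_eq_of_infinite
  have hiff : t.Countable ↔ u.Countable := by
    rw [← Cardinal.le_aleph0_iff_set_countable, ← Cardinal.le_aleph0_iff_set_countable, hc]
  have ht : ¬ t.Countable := fun h => hs (htu ▸ h.union (hiff.1 h))
  exact ⟨t, u, htu, hd, ht, fun h => ht (hiff.2 h)⟩

/-- If `X` is open Whyburn and `Q_p(X, ℝ)` is Fréchet–Urysohn, then every set of isolated points is
countable. -/
lemma countable_of_forall_isOpen_singleton [T1Space X] (hw : OpenWhyburn X)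
    (hFU : FrechetUrysohnSpace (Qp X)) {D : Set X} (hD : ∀ x ∈ D, IsOpen {x}) :
    D.Countable := by
  have hopen : ∀ E ⊆ D, IsOpen E := fun E hE => by
    rw [← biUnion_of_singleton E]
    exact isOpen_biUnion fun x hx => hD x (hE hx)
  have hclosure : ∀ E, closure E ∩ D ⊆ E := fun E x hx => by
    obtain ⟨y, rfl, hy⟩ := mem_closure_iff.1 hx.1 {x} (hD x hx.2) rfl
    exact hy
  refine countable_of_forall_exists_isOpen hFU D fun x => ?_
  by_cases hxD : x ∈ D
  · exact ⟨{x}, hD x hxD, subset_closure rfl, (countable_singleton x).mono (by simp)⟩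
  by_cases hxc : x ∈ closure D
  swap
  · refine ⟨(closure D)ᶜ, isClosed_closure.isOpen_compl, subset_closure hxc, ?_⟩
    refine countable_empty.mono fun y hy => ?_
    exact hclosure _ hy (subset_closure hy.2)
  obtain ⟨B, hB, hBD, hBx⟩ := hw D (hopen D Subset.rfl) x ⟨hxc, hxD⟩
  have hxB : x ∈ closure B := (hBx.symm ▸ mem_singleton x : x ∈ closure B \ D).1
  refine ⟨B, hB, hxB, ?_⟩
  suffices hBc : B.Countable from hBc.mono (hclosure B)
  by_contra hBc
  obtain ⟨s, t, rfl, hd, hs, ht⟩ := Set.exists_disjoint_not_countable hBc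
  have key : ∀ E F : Set X, E ∪ F = s ∪ t → Disjoint E F → x ∈ closure F → E.Countable := by
    intro E F hEF hdEF hxF
    have hED : E ⊆ D := (subset_union_left.trans hEF.subset).trans hBD
    have hFD : F ⊆ D := (subset_union_right.trans hEF.subset).trans hBD
    refine countable_of_forall_exists_isOpen hFU E fun y => ?_
    by_cases hyE : y ∈ E
    · exact ⟨{y}, hD y (hED hyE), subset_closure rfl, (countable_singleton y).mono (by simp)⟩
    by_cases hyx : y ∈ closure F
    · refine ⟨F, hopen F hFD, hyx, countable_empty.mono fun z hz => ?_⟩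
      exact hdEF.le_bot ⟨hz.2, hclosure F ⟨hz.1, hED hz.2⟩⟩
    · have hyc : y ∉ closure E := fun h => by
        by_cases hyD : y ∈ D
        · exact hyE (hclosure E ⟨h, hyD⟩)
        · have : y ∈ closure (s ∪ t) \ D :=
            ⟨closure_mono (subset_union_left.trans hEF.subset) h, hyD⟩
          rw [hBx] at this
          exact hyx (this ▸ hxF)
      refine ⟨(closure E)ᶜ, isClosed_closure.isOpen_compl, subset_closure hyc, ?_⟩
      refine countable_empty.mono fun z hz => ?_
      exact hclosure _ ⟨hz.1, hED hz.2⟩ (subset_closure hz.2)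
  rw [closure_union] at hxB
  rcases hxB with hxs | hxt
  · exact ht (key t s (union_comm t s) hd.symm hxs)
  · exact hs (key s t rfl hd hxt)

/-- A disjoint family of nonempty open sets is countable if closed sets with empty interior and
sets of isolated points are. -/
lemma countable_of_pairwiseDisjoint_isOpen [T1Space X]
    (hnd : ∀ N : Set X, IsClosed N → interior N = ∅ → N.Countable)
    (hiso : ∀ D : Set X, (∀ x ∈ D, IsOpen {x}) → D.Countable) {𝒱 : Set (Set X)}
    (hd : 𝒱.PairwiseDisjoint id) (ho : ∀ V ∈ 𝒱, IsOpen V) (hne : ∀ V ∈ 𝒱, V.Nonempty) :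
    𝒱.Countable := by
  rcases isEmpty_or_nonempty X with hX | hX
  · exact countable_empty.mono fun V hV => isEmptyElim (hne V hV).some
  choose! p hp using hne
  have heq : ∀ V ∈ 𝒱, ∀ W ∈ 𝒱, p W ∈ V → V = W := fun V hV W hW h =>
    hd.elim_set hV hW (p W) h (hp W hW)
  have hinj : InjOn p 𝒱 := fun V hV W hW h => heq V hV W hW (h ▸ hp V hV)
  refine countable_of_injective_of_countable_image hinj ?_
  have h₁ := hiso {x ∈ p '' 𝒱 | IsOpen {x}} fun x hx => hx.2
  have h₂ := hnd (closure {x ∈ p '' 𝒱 | ¬ IsOpen {x}}) isClosed_closure <| by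
    set D := {x ∈ p '' 𝒱 | ¬ IsOpen {x}}
    refine eq_empty_of_forall_notMem fun y hy => ?_
    obtain ⟨_, hO, ⟨V, hV, rfl⟩, hVo⟩ :=
      mem_closure_iff.1 (interior_subset hy) _ isOpen_interior hy
    refine hVo ?_
    have hOV : interior (closure D) ∩ V = {p V} := by
      refine Subset.antisymm (fun z hz => ?_) (singleton_subset_iff.2 ⟨hO, hp V hV⟩)
      by_contra hzV
      obtain ⟨_, hW', ⟨W, hW, rfl⟩, -⟩ := mem_closure_iff.1 (interior_subset hz.1) (V \ {p V})
        ((ho V hV).sdiff isClosed_singleton) ⟨hz.2, hzV⟩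
      exact hW'.2 (by rw [heq V hV W hW hW'.1]; rfl)
    exact hOV ▸ isOpen_interior.inter (ho V hV)
  refine (h₁.union h₂).mono fun x hx => ?_
  by_cases hxo : IsOpen {x}
  · exact Or.inl ⟨hx, hxo⟩
  · exact Or.inr (subset_closure ⟨hx, hxo⟩)

/-- A space is hereditarily Lindelöf if its closed sets with empty interior and its disjoint
families of nonempty open sets are countable. -/
lemma hereditarilyLindelofSpace_of_countable
    (hnd : ∀ N : Set X, IsClosed N → interior N = ∅ → N.Countable)
    (hccc : ∀ 𝒱 : Set (Set X), 𝒱.PairwiseDisjoint id → (∀ V ∈ 𝒱, IsOpen V) →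
      (∀ V ∈ 𝒱, V.Nonempty) → 𝒱.Countable) :
    HereditarilyLindelofSpace X := by
  refine ⟨fun s _ => isLindelof_of_countable_subcover fun {ι} U hU hsU => ?_⟩
  rcases isEmpty_or_nonempty ι with hι | hι
  · exact ⟨∅, countable_empty, by simpa using hsU⟩
  obtain ⟨𝒱, ⟨hd, hV⟩, hmax⟩ := zorn_subset
    {𝒱 : Set (Set X) | 𝒱.PairwiseDisjoint id ∧
      ∀ V ∈ 𝒱, IsOpen V ∧ V.Nonempty ∧ ∃ i, V ⊆ U i} fun c hc hchain =>
    ⟨⋃₀ c, ⟨(pairwiseDisjoint_sUnion hchain.directedOn).2 fun a ha => (hc ha).1,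
      fun V ⟨a, ha, hVa⟩ => (hc ha).2 V hVa⟩, fun a ha => subset_sUnion_of_mem ha⟩
  have hc : 𝒱.Countable := hccc 𝒱 hd (fun V h => (hV V h).1) fun V h => (hV V h).2.1
  choose! i hi using fun V h => (hV V h).2.2
  have hopen : IsOpen (⋃₀ 𝒱) := isOpen_sUnion fun V h => (hV V h).1
  have hsub : (⋃ j, U j) ⊆ closure (⋃₀ 𝒱) := by
    intro x hx
    obtain ⟨j, hj⟩ := mem_iUnion.1 hx
    by_contra hxc
    set W := U j ∩ (closure (⋃₀ 𝒱))ᶜ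
    have hxW : x ∈ W := ⟨hj, hxc⟩
    have hWV : ∀ V ∈ 𝒱, Disjoint W V := fun V h => disjoint_left.2 fun y hy hyV =>
      hy.2 (subset_closure ⟨V, h, hyV⟩)
    have hmem : W ∈ 𝒱 := hmax (y := insert W 𝒱)
      ⟨hd.insert fun V h _ => hWV V h, by
        rintro V (rfl | h)
        · exact ⟨(hU j).inter isClosed_closure.isOpen_compl, ⟨x, hxW⟩, j, inter_subset_left⟩
        · exact hV V h⟩ (subset_insert W 𝒱) (mem_insert W 𝒱)
    exact (hWV W hmem).le_bot ⟨hxW, hxW⟩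
  have hN : (closure (⋃₀ 𝒱) \ ⋃₀ 𝒱).Countable := by
    refine hnd _ (isClosed_closure.sdiff hopen) (eq_empty_of_forall_notMem fun y hy => ?_)
    obtain ⟨z, hz, hz'⟩ := mem_closure_iff.1 (interior_subset hy).1 _ isOpen_interior hy
    exact (interior_subset hz).2 hz'
  have hR : (s \ ⋃₀ 𝒱).Countable := hN.mono (sdiff_subset_sdiff_left (hsU.trans hsub))
  choose! k hk using fun x (hx : x ∈ s) => mem_iUnion.1 (hsU hx)
  refine ⟨i '' 𝒱 ∪ k '' (s \ ⋃₀ 𝒱), (hc.image i).union (hR.image k), fun x hx => ?_⟩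
  by_cases hx𝒱 : x ∈ ⋃₀ 𝒱
  · obtain ⟨V, h, hxV⟩ := hx𝒱
    exact mem_biUnion (Or.inl (mem_image_of_mem i h)) (hi V h hxV)
  · exact mem_biUnion (Or.inr (mem_image_of_mem k ⟨hx, hx𝒱⟩)) (hk x hx)

end Helpers

theorem hereditarilyLindelof_of_qp_frechetUrysohn
    (X : Type*) [TopologicalSpace X] [T2Space X] (hsr : SemiRegular X)
    (hw : OpenWhyburn X) [Uncountable X] (hFU : FrechetUrysohnSpace (Qp X)) :
    HereditarilyLindelofSpace X := by
  have hnd : ∀ N : Set X, IsClosed N → interior N = ∅ → N.Countable := fun N hN hN0 =>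
    hN.countable_of_interior_eq_empty hw hFU hN0
  exact hereditarilyLindelofSpace_of_countable hnd fun 𝒱 hd ho hne =>
    countable_of_pairwiseDisjoint_isOpen hnd
      (fun D hD => countable_of_forall_isOpen_singleton hw hFU hD) hd ho hne
end
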